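/- arXiv:1601.08122 — 6 statements merged into one kernel-verified Lean document; each statement's English description precedes it below -/
import Mathlib

section
/- Define polynomial sequences p_n, q_n ∈ ℂ[X] by p_0 = 0, q_0 = 1, p_{n+1} = 2X(X+1)·q_n − X²(1+3X)·p_n and q_{n+1} = (X+3)·q_n − 2X(X+1)·p_n. Then for every n ≥ 1, p_n ≠ 0, q_n ≠ 0, deg(p_n) = 3n − 1 and deg(q_n) = 3n − 2; in particular deg(p_n) = deg(q_n) + 1. -/
open Polynomial

noncomputable def groverPQ : ℕ → Polynomial ℂ × Polynomial ℂ
  | 0 => (0, 1)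
  | n + 1 =>
      (2 * X * (X + 1) * (groverPQ n).2 - X ^ 2 * (1 + 3 * X) * (groverPQ n).1,
       (X + 3) * (groverPQ n).2 - 2 * X * (X + 1) * (groverPQ n).1)

theorem natDegree_groverPQ_succ (k : ℕ) :
    (groverPQ (k + 1)).1.natDegree = 3 * k + 2 ∧ (groverPQ (k + 1)).2.natDegree = 3 * k + 1 := by
  have hquad : (2 * X * (X + 1) : ℂ[X]).natDegree = 2 := by compute_degree!
  have hcubic : (X ^ 2 * (1 + 3 * X) : ℂ[X]).natDegree = 3 := by compute_degree!
  have hlin : (X + 3 : ℂ[X]).natDegree = 1 := by compute_degree!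
  induction k with
  | zero => simp [groverPQ, hquad, hlin]
  | succ k ih =>
    obtain ⟨hp, hq⟩ := ih
    rw [groverPQ]
    generalize (groverPQ (k + 1)).1 = p at *
    generalize (groverPQ (k + 1)).2 = q at *
    have hp0 : p ≠ 0 := ne_zero_of_natDegree_gt (n := 0) (by omega)
    have hq0 : q ≠ 0 := ne_zero_of_natDegree_gt (n := 0) (by omega)
    have hquad0 : (2 * X * (X + 1) : ℂ[X]) ≠ 0 := ne_zero_of_natDegree_gt (n := 0) (by omega)
    have hcubic0 : (X ^ 2 * (1 + 3 * X) : ℂ[X]) ≠ 0 := ne_zero_of_natDegree_gt (n := 0) (by omega)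
    have hlin0 : (X + 3 : ℂ[X]) ≠ 0 := ne_zero_of_natDegree_gt (n := 0) (by omega)
    have h₁ := natDegree_mul hquad0 hq0
    have h₂ := natDegree_mul hcubic0 hp0
    have h₃ := natDegree_mul hlin0 hq0
    have h₄ := natDegree_mul hquad0 hp0
    constructor
    · rw [natDegree_sub_eq_right_of_natDegree_lt] <;> omega
    · rw [natDegree_sub_eq_right_of_natDegree_lt] <;> omega

theorem stmt_5 (n : ℕ) (hn : 1 ≤ n) :
    (groverPQ n).1 ≠ 0 ∧ (groverPQ n).2 ≠ 0 ∧
    (groverPQ n).1.natDegree = 3 * n - 1 ∧ (groverPQ n).2.natDegree = 3 * n - 2 ∧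
    (groverPQ n).1.natDegree = (groverPQ n).2.natDegree + 1 := by
  obtain ⟨k, rfl⟩ := Nat.exists_eq_add_of_le' hn
  obtain ⟨hp, hq⟩ := natDegree_groverPQ_succ k
  exact ⟨ne_zero_of_natDegree_gt (n := 0) (by omega), ne_zero_of_natDegree_gt (n := 0) (by omega),
    by omega, by omega, by omega⟩
end

section
/- Define polynomial sequences p_n, q_n ∈ ℂ[X] by p_0 = 0, q_0 = 1, p_{n+1} = 2X(X+1)·q_n − X²(1+3X)·p_n and q_{n+1} = (X+3)·q_n − 2X(X+1)·p_n. Then for every n ∈ ℕ and every z ∈ ℂ with z ≠ 0, the following identity holds: (3z² − 2z + 3)·p_n(z)·p_n(1/z) = 2z·( p_n(z)·q_n(1/z) + p_n(1/z)·q_n(z) ). -/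
open Polynomial

/-- The transfer matrix `M z` satisfies `M (1 / z) = -z⁻³ • adjugate (M z)`; writing
`M z ^ n = α + β • M z`, both `(p_n, q_n)` at `z` and at `1 / z` are expressed through `α, β`. -/
theorem groverPQ_eval_pair (n : ℕ) (z : ℂ) (hz : z ≠ 0) :
    ∃ α β κ : ℂ,
      (groverPQ n).1.eval z = β * (2 * z * (z + 1)) ∧
      (groverPQ n).2.eval z = α + β * (z + 3) ∧
      (groverPQ n).1.eval (1 / z) = -(κ * β * (2 * z * (z + 1))) ∧
      (groverPQ n).2.eval (1 / z) = κ * (α - β * (z ^ 2 * (1 + 3 * z))) := by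
  induction n with
  | zero => exact ⟨1, 0, 1, by simp [groverPQ]⟩
  | succ n ih =>
    obtain ⟨α, β, κ, hp, hq, hp', hq'⟩ := ih
    refine ⟨-((2 * z * (z + 1)) ^ 2 - (z + 3) * (z ^ 2 * (1 + 3 * z))) * β,
      α + (z + 3 - z ^ 2 * (1 + 3 * z)) * β, -κ / z ^ 3, ?_, ?_, ?_, ?_⟩ <;>
    simp only [groverPQ, eval_sub, eval_add, eval_mul, eval_pow, eval_X, eval_one, eval_ofNat,
      hp, hq, hp', hq'] <;>
    field_simp <;>
    ring

theorem stmt_11 (n : ℕ) (z : ℂ) (hz : z ≠ 0) :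
    (3 * z ^ 2 - 2 * z + 3) * (groverPQ n).1.eval z * (groverPQ n).1.eval (1 / z) =
      2 * z * ((groverPQ n).1.eval z * (groverPQ n).2.eval (1 / z) +
        (groverPQ n).1.eval (1 / z) * (groverPQ n).2.eval z) := by
  obtain ⟨α, β, κ, hp, hq, hp', hq'⟩ := groverPQ_eval_pair n z hz
  rw [hp, hq, hp', hq']
  ring
end

section
/- Let ω = 1/3 + (2√2/3)·i ∈ ℂ, and define the sequence a : ℕ → ℂ by a_0 = 0 and a_{n+1} = (2ω(ω+1) − ω²(1+3ω)·a_n) / ((ω+3) − 2ω(ω+1)·a_n). Then for every n ∈ ℕ, (ω+3) − 2ω(ω+1)·a_n ≠ 0 and a_n is purely imaginary, i.e. Re(a_n) = 0. -/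
theorem stmt_12 (ω : ℂ) (hω : ω = 1 / 3 + (2 * Real.sqrt 2 / 3) * Complex.I)
    (a : ℕ → ℂ) (ha0 : a 0 = 0)
    (ha : ∀ n, a (n + 1) =
      (2 * ω * (ω + 1) - ω ^ 2 * (1 + 3 * ω) * a n) /
        ((ω + 3) - 2 * ω * (ω + 1) * a n)) (n : ℕ) :
    (ω + 3) - 2 * ω * (ω + 1) * a n ≠ 0 ∧ (a n).re = 0 := by
  obtain ⟨k, hk⟩ : ∃ k : ℝ, k = 2 * Real.sqrt 2 / 3 := ⟨_, rfl⟩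
  have hk0 : 0 ≤ k := by rw [hk]; positivity
  have hk2 : (k : ℂ) ^ 2 = 8 / 9 := by
    have h : k ^ 2 = 8 / 9 := by
      rw [hk, div_pow, mul_pow, Real.sq_sqrt zero_le_two]
      norm_num
    rw [← Complex.ofReal_pow, h]
    norm_num
  have hωk : ω = 1 / 3 + k * Complex.I := by rw [hω, hk]; push_cast; ring
  have hI := Complex.I_sq
  have hmin : 3 * ω ^ 2 - 2 * ω + 3 = 0 := by
    rw [hωk]; linear_combination 3 * (k : ℂ) ^ 2 * hI - 3 * hk2
  have hnum : 2 * ω * (ω + 1) = (ω + 3) * (k * Complex.I) := by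
    have hkI : (k : ℂ) * Complex.I = ω - 1 / 3 := by rw [hωk]; ring
    rw [hkI]; linear_combination hmin / 3
  have hcoeff : ω ^ 2 * (1 + 3 * ω) = -(ω + 3) := by
    linear_combination (ω + 1) * hmin
  have hω3 : ω + 3 ≠ 0 := by
    intro h
    have := congrArg Complex.re h
    norm_num [hωk] at this
  have hden (t : ℝ) : (ω + 3) - 2 * ω * (ω + 1) * (t * Complex.I) =
      (ω + 3) * ((1 + k * t : ℝ) : ℂ) := by
    rw [hnum]; push_cast; linear_combination -(ω + 3) * k * t * hI
  have hden_ne (t : ℝ) (ht : 0 ≤ t) : ((1 + k * t : ℝ) : ℂ) ≠ 0 :=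
    Complex.ofReal_ne_zero.mpr (by positivity)
  have himag (n : ℕ) : ∃ t : ℝ, 0 ≤ t ∧ a n = t * Complex.I := by
    induction n with
    | zero => exact ⟨0, le_rfl, by simp [ha0]⟩
    | succ n ih =>
      obtain ⟨t, ht, hat⟩ := ih
      refine ⟨(k + t) / (1 + k * t), by positivity, ?_⟩
      rw [ha, hat, hden, hnum, hcoeff, div_eq_iff (mul_ne_zero hω3 (hden_ne t ht)),
        Complex.ofReal_div]
      have hne := hden_ne t ht
      field_simp
      push_cast
      ring
  obtain ⟨t, ht, hat⟩ := himag n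
  rw [hat, hden]
  exact ⟨mul_ne_zero hω3 (hden_ne t ht), by simp⟩
end

section
/- Let ω = 1/3 + (2√2/3)·i ∈ ℂ, define a : ℕ → ℂ by a_0 = 0 and a_{n+1} = (2ω(ω+1) − ω²(1+3ω)·a_n) / ((ω+3) − 2ω(ω+1)·a_n), and set p_n := −(i/√2)·a_n for n ∈ ℕ. Then for every n ∈ ℕ, p_n is a nonnegative real number, p_0 = 0, and p_{n+1} = (2 + 3·p_n) / (3 + 4·p_n). -/
theorem stmt_13 (ω : ℂ) (hω : ω = 1 / 3 + (2 * Real.sqrt 2 / 3) * Complex.I)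
    (a : ℕ → ℂ) (ha0 : a 0 = 0)
    (ha : ∀ n, a (n + 1) =
      (2 * ω * (ω + 1) - ω ^ 2 * (1 + 3 * ω) * a n) /
        ((ω + 3) - 2 * ω * (ω + 1) * a n))
    (p : ℕ → ℂ) (hp : ∀ n, p n = -(Complex.I / Real.sqrt 2) * a n) :
    (∀ n, (p n).im = 0 ∧ 0 ≤ (p n).re) ∧ p 0 = 0 ∧
    ∀ n, p (n + 1) = (2 + 3 * p n) / (3 + 4 * p n) := by
  set s : ℂ := (Real.sqrt 2 : ℂ) with hs
  have hs2 : s ^ 2 = 2 := by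
    rw [hs, ← Complex.ofReal_pow, Real.sq_sqrt (by norm_num)]
    norm_num
  have hs0 : s ≠ 0 := by
    intro h
    norm_num [h] at hs2
  have hI : Complex.I ^ 2 = -1 := Complex.I_sq
  have hω3 : ω + 3 ≠ 0 := by
    intro h
    have h2 : (3 * ω - 1) ^ 2 = -8 := by
      rw [hω]
      linear_combination 4 * s ^ 2 * hI - 4 * hs2
    rw [eq_neg_of_add_eq_zero_left h] at h2
    norm_num at h2
  have hpa (n : ℕ) : a n = Complex.I * s * p n := by
    rw [hp]
    field_simp
    linear_combination a n * hI
  have hsI : Complex.I * s = (3 * ω - 1) / 2 := by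
    rw [hω]
    ring
  have hq : 3 * ω ^ 2 = 2 * ω - 3 := by
    rw [hω]
    linear_combination (4 / 3) * s ^ 2 * hI - (4 / 3) * hs2
  have hrec (n : ℕ) : p (n + 1) = (2 + 3 * p n) / (3 + 4 * p n) := by
    have hnum : 2 * ω * (ω + 1) - ω ^ 2 * (1 + 3 * ω) * a n =
        (ω + 3) / 3 * (Complex.I * s * (2 + 3 * p n)) := by
      rw [hpa, hsI]
      linear_combination (1 / 3 - p n / 2 * (3 * ω ^ 2 + 2 * ω - 1)) * hq
    have hden : ω + 3 - 2 * ω * (ω + 1) * a n = (ω + 3) / 3 * (3 + 4 * p n) := by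
      rw [hpa, hsI]
      linear_combination (-p n * (ω + 4 / 3)) * hq
    rw [hp, ha, hnum, hden, mul_div_mul_left _ _ (div_ne_zero hω3 three_ne_zero)]
    field_simp
    rw [hI]
    ring
  have hp0 : p 0 = 0 := by rw [hp, ha0, mul_zero]
  have hreal (n : ℕ) : ∃ r : ℝ, 0 ≤ r ∧ p n = r := by
    induction n with
    | zero => exact ⟨0, le_rfl, by simp [hp0]⟩
    | succ n ih =>
      obtain ⟨r, hr, h⟩ := ih
      refine ⟨(2 + 3 * r) / (3 + 4 * r), by positivity, ?_⟩
      rw [hrec, h]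
      push_cast
      rfl
  refine ⟨fun n => ?_, hp0, hrec⟩
  obtain ⟨r, hr, h⟩ := hreal n
  simp [h, hr]
end

section
/- Define the real sequence q : ℕ → ℝ by q_0 = 0 and q_{n+1} = (2 + 3·q_n)/(3 + 4·q_n). Then for every n ∈ ℕ, 0 ≤ q_n < 1/√2 and q_n < q_{n+1}; that is, the sequence is strictly increasing and bounded above by 1/√2. -/
theorem nonneg_and_two_mul_sq_lt_one {q : ℕ → ℝ} (hq0 : q 0 = 0)
    (hq : ∀ n, q (n + 1) = (2 + 3 * q n) / (3 + 4 * q n)) (n : ℕ) :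
    0 ≤ q n ∧ 2 * q n ^ 2 < 1 := by
  induction n with
  | zero => simp [hq0]
  | succ k ih =>
    obtain ⟨h0, h1⟩ := ih
    rw [hq]
    refine ⟨by positivity, ?_⟩
    rw [div_pow, ← mul_div_assoc, div_lt_one (by positivity)]
    linarith

theorem stmt_14 (q : ℕ → ℝ) (hq0 : q 0 = 0)
    (hq : ∀ n, q (n + 1) = (2 + 3 * q n) / (3 + 4 * q n)) (n : ℕ) :
    0 ≤ q n ∧ q n < 1 / Real.sqrt 2 ∧ q n < q (n + 1) := by
  obtain ⟨h0, h1⟩ := nonneg_and_two_mul_sq_lt_one hq0 hq n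
  refine ⟨h0, ?_, ?_⟩
  · rw [lt_div_iff₀ (by positivity)]
    refine lt_of_pow_lt_pow_left₀ 2 zero_le_one ?_
    rw [mul_pow, Real.sq_sqrt zero_le_two]
    linarith
  · rw [hq, lt_div_iff₀ (by positivity)]
    linarith
end

section
/- Define the real sequence q : ℕ → ℝ by q_0 = 0 and q_{n+1} = (2 + 3·q_n)/(3 + 4·q_n). Then the sequence (q_n) converges, and its limit is 1/√2. -/
theorem stmt_15 (q : ℕ → ℝ) (hq0 : q 0 = 0)
    (hq : ∀ n, q (n + 1) = (2 + 3 * q n) / (3 + 4 * q n)) :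
    Filter.Tendsto q Filter.atTop (nhds (1 / Real.sqrt 2)) := by
  have hs0 : 0 < 1 / Real.sqrt 2 := by positivity
  have hs2 : (1 / Real.sqrt 2) ^ 2 = 1 / 2 := by
    rw [div_pow, Real.sq_sqrt (by norm_num), one_pow]
  set s := 1 / Real.sqrt 2
  have hnonneg : ∀ n, 0 ≤ q n := by
    intro n
    induction n with
    | zero => exact hq0.ge
    | succ n ih => rw [hq]; positivity
  have hcoef : |3 - 4 * s| ≤ 1 := by
    rw [abs_le]
    constructor <;> nlinarith
  have hcontract : ∀ n, |q (n + 1) - s| ≤ 1 / 3 * |q n - s| := by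
    intro n
    have hpos : 0 < 3 + 4 * q n := by linarith [hnonneg n]
    have heq : q (n + 1) - s = (3 - 4 * s) * (q n - s) / (3 + 4 * q n) := by
      rw [hq, eq_div_iff hpos.ne', sub_mul, div_mul_cancel₀ _ hpos.ne']
      linear_combination (-4) * hs2
    rw [heq, abs_div, abs_mul, abs_of_pos hpos, div_le_iff₀ hpos]
    nlinarith [mul_le_mul_of_nonneg_right hcoef (abs_nonneg (q n - s)),
      mul_nonneg (hnonneg n) (abs_nonneg (q n - s))]
  have hbound : ∀ n, |q n - s| ≤ (1 / 3) ^ n * |q 0 - s| := by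
    intro n
    induction n with
    | zero => simp
    | succ n ih => rw [pow_succ]; linarith [hcontract n]
  have hlim : Filter.Tendsto (fun n : ℕ => (1 / 3 : ℝ) ^ n * |q 0 - s|) Filter.atTop (nhds 0) := by
    simpa only [zero_mul] using
      (tendsto_pow_atTop_nhds_zero_of_lt_one (r := (1 / 3 : ℝ)) (by norm_num)
        (by norm_num)).mul_const |q 0 - s|
  rw [tendsto_iff_dist_tendsto_zero]
  exact squeeze_zero (fun _ => dist_nonneg) hbound hlim
end
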